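/- Suppose Assumptions 1–4 below hold (with δ_H ∈ [0,1]), the noise satisfies the second-moment martingale-difference condition, and the step sizes satisfy the appendix step-size assumption. Then for every t ≥ 0, almost surely E[‖x̂_{t+1}‖² | F_t] ≤ (1 − μ_Fα_t)‖x̂_t‖² + 4L_H²L_{G,y}²β_t²‖ŷ_t‖² + 2Γ₁₁α_t² + 7L_H L_{G,y} β_t√(1 − μ_Fα_t)·‖x̂_t‖‖ŷ_t‖ + 2L_H²Γ₂₂β_t² + (16S_H²Γ₂₂^{1+δ_H}/μ_F)·β_t^{2+2δ_H}/α_t. -/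

import Mathlib

set_option autoImplicit false

open MeasureTheory Filter
open scoped RealInnerProductSpace

noncomputable section

/-- Spectral norm of a rectangular real matrix (the operator norm of the induced
linear map between Euclidean spaces). -/
def specNorm {m n : ℕ} (A : Matrix (Fin m) (Fin n) ℝ) : ℝ :=
  ‖LinearMap.toContinuousLinearMap (Matrix.toEuclideanLin A)‖

/-- The σ-algebra `𝔉 t = σ(x₀, y₀, ξ₀, ψ₀, …, ξ_{t-1}, ψ_{t-1})`. -/
def natFilt {Ω : Type} [MeasurableSpace Ω] {dx dy : ℕ}
    (x0 : Ω → EuclideanSpace ℝ (Fin dx)) (y0 : Ω → EuclideanSpace ℝ (Fin dy))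
    (ξ : ℕ → Ω → EuclideanSpace ℝ (Fin dx)) (ψ : ℕ → Ω → EuclideanSpace ℝ (Fin dy))
    (t : ℕ) : MeasurableSpace Ω :=
  MeasurableSpace.comap x0 inferInstance ⊔ MeasurableSpace.comap y0 inferInstance ⊔
    ⨆ s ∈ Finset.range t,
      (MeasurableSpace.comap (ξ s) inferInstance ⊔ MeasurableSpace.comap (ψ s) inferInstance)

/-- Conditional Jensen inequality for powers with exponent in `[0, 1]`. -/
lemma condExp_rpow_le_of_condExp_le {Ω : Type*} {m mΩ : MeasurableSpace Ω} {μ : Measure Ω}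
    [IsFiniteMeasure μ] (hm : m ≤ mΩ) {f : Ω → ℝ} (hf0 : ∀ ω, 0 ≤ f ω) (hf : Integrable f μ)
    {C p : ℝ} (hp0 : 0 ≤ p) (hp1 : p ≤ 1) (hC : ∀ᵐ ω ∂μ, (μ[f | m]) ω ≤ C) :
    Integrable (fun ω => f ω ^ p) μ ∧ ∀ᵐ ω ∂μ, (μ[fun ω => f ω ^ p | m]) ω ≤ C ^ p := by
  have hint : Integrable (fun ω => f ω ^ p) μ := by
    refine ((integrable_const (1 : ℝ)).add hf).mono'
      (hf.aestronglyMeasurable.aemeasurable.pow_const p).aestronglyMeasurable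
      (Eventually.of_forall fun ω => ?_)
    rw [Real.norm_of_nonneg (Real.rpow_nonneg (hf0 ω) p)]
    have h1 : f ω ^ p ≤ (1 + f ω) ^ p :=
      Real.rpow_le_rpow (hf0 ω) (by linarith) hp0
    exact h1.trans (Real.rpow_le_self_of_one_le (by linarith [hf0 ω]) hp1)
  refine ⟨hint, ?_⟩
  have hJ := (Real.concaveOn_rpow hp0 hp1).condExp_map_le (f := f) (μ := μ) hm
    (Real.continuous_rpow_const hp0).continuousOn.upperSemicontinuousOn
    (Eventually.of_forall hf0) isClosed_Ici hf hint
  filter_upwards [hJ, hC, condExp_nonneg (m := m) (Eventually.of_forall hf0 : 0 ≤ᵐ[μ] f)]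
    with ω h1 h2 h3
  exact h1.trans (Real.rpow_le_rpow h3 h2 hp0)

section InnerProduct

variable {E : Type*} [NormedAddCommGroup E] [InnerProductSpace ℝ E]
  {E' : Type*} [NormedAddCommGroup E'] [InnerProductSpace ℝ E']

lemma MeasureTheory.MemLp.integrable_inner_of_two {Ω : Type*} {mΩ : MeasurableSpace Ω}
    {μ : Measure Ω} {u v : Ω → E} (hu : MemLp u 2 μ) (hv : MemLp v 2 μ) :
    Integrable (fun ω => ⟪u ω, v ω⟫) μ :=
  (hu.norm.integrable_mul hv.norm).mono'
    (hu.aestronglyMeasurable.inner hv.aestronglyMeasurable)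
    (Eventually.of_forall fun ω => norm_inner_le_norm (u ω) (v ω))

/-- A conditionally centred vector is conditionally orthogonal to every measurable vector. -/
lemma condExp_inner_eq_zero [CompleteSpace E] {Ω : Type*} {m mΩ : MeasurableSpace Ω}
    {μ : Measure Ω} [IsFiniteMeasure μ] {u v : Ω → E} (hum : StronglyMeasurable[m] u)
    (hu : MemLp u 2 μ) (hv : MemLp v 2 μ) (hv0 : μ[v | m] =ᵐ[μ] 0) :
    μ[fun ω => ⟪u ω, v ω⟫ | m] =ᵐ[μ] 0 := by
  have h : μ[fun ω => ⟪u ω, v ω⟫ | m] =ᵐ[μ] fun ω => ⟪u ω, (μ[v | m]) ω⟫ :=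
    condExp_bilin_of_stronglyMeasurable_left (innerSL ℝ) hum
      (hu.integrable_inner_of_two hv) (hv.integrable one_le_two)
  filter_upwards [h, hv0] with ω h1 h2
  rw [h1, h2]
  exact inner_zero_right _

/-- Pointwise expansion of the squared norm of the perturbed vector `a - α ξ + D₁ + r + β L ψ`. -/
lemma norm_sq_add_perturbation_le [CompleteSpace E] [CompleteSpace E'] (L : E' →L[ℝ] E)
    (a ξ D₁ r : E) (g ψ : E') {α β l : ℝ}
    (hD₁ : ‖D₁‖ ≤ l * (β * ‖g‖)) (hD : ‖D₁ + (r + β • L ψ)‖ ≤ l * (β * ‖g + ψ‖)) :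
    ‖a - α • ξ + (D₁ + (r + β • L ψ))‖ ^ 2 ≤
      (‖a‖ ^ 2 + 2 * l * β * (‖a‖ * ‖g‖) + 2 * l ^ 2 * β ^ 2 * ‖g‖ ^ 2) + 2 * (‖a‖ * ‖r‖) +
      ⟪(2 * β) • L.adjoint a + (4 * l ^ 2 * β ^ 2) • g, ψ⟫ + ⟪(-2 * α) • a, ξ⟫ +
      (2 * α ^ 2) * ‖ξ‖ ^ 2 + (2 * l ^ 2 * β ^ 2) * ‖ψ‖ ^ 2 := by
  set D := D₁ + (r + β • L ψ) with hDdef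
  have h1 : ‖a - α • ξ + D‖ ^ 2 =
      ‖a‖ ^ 2 + 2 * ⟪a, D⟫ - 2 * α * ⟪a, ξ⟫ + ‖D - α • ξ‖ ^ 2 := by
    rw [show a - α • ξ + D = a + (D - α • ξ) by abel, norm_add_sq_real, inner_sub_right,
      inner_smul_right]
    ring
  have h2 : ‖D - α • ξ‖ ^ 2 ≤ 2 * α ^ 2 * ‖ξ‖ ^ 2 + 2 * ‖D‖ ^ 2 := by
    have h := norm_sub_le D (α • ξ)
    have h' : ‖α • ξ‖ ^ 2 = α ^ 2 * ‖ξ‖ ^ 2 := by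
      rw [norm_smul, mul_pow, Real.norm_eq_abs, sq_abs]
    nlinarith [norm_nonneg (D - α • ξ), sq_nonneg (‖D‖ - ‖α • ξ‖),
      mul_self_le_mul_self (norm_nonneg (D - α • ξ)) h]
  have h3 : ‖D‖ ^ 2 ≤ l ^ 2 * β ^ 2 * (‖g‖ ^ 2 + 2 * ⟪g, ψ⟫ + ‖ψ‖ ^ 2) := by
    rw [← norm_add_sq_real]
    calc ‖D‖ ^ 2 ≤ (l * (β * ‖g + ψ‖)) ^ 2 := by gcongr
      _ = _ := by ring
  have h4 : ⟪a, D⟫ = ⟪a, D₁⟫ + ⟪a, r⟫ + β * ⟪L.adjoint a, ψ⟫ := by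
    rw [hDdef, inner_add_right, inner_add_right, inner_smul_right,
      ContinuousLinearMap.adjoint_inner_left]
    ring
  have h5 : ⟪a, D₁⟫ ≤ ‖a‖ * (l * (β * ‖g‖)) :=
    (real_inner_le_norm a D₁).trans (by gcongr)
  have h6 := real_inner_le_norm a r
  rw [inner_add_left, inner_smul_left, inner_smul_left, inner_smul_left]
  simp only [conj_trivial]
  nlinarith

/-- One step of a perturbed recursion `a - α ξ + (H Y - H (Y - β (g + ψ)))` with conditionally
centred noise, for a Lipschitz map `H` whose derivative is Hölder continuous in the Taylor sense. -/
lemma condExp_norm_sq_step_le [FiniteDimensional ℝ E] [FiniteDimensional ℝ E']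
    [MeasurableSpace E'] [BorelSpace E']
    {Ω : Type*} {m mΩ : MeasurableSpace Ω} {μ : Measure Ω} [IsProbabilityMeasure μ] (hm : m ≤ mΩ)
    {H : E' → E} {l : ℝ} (hl : 0 ≤ l)
    (hlip : ∀ y₁ y₂, ‖H y₁ - H y₂‖ ≤ l * ‖y₁ - y₂‖) {S δ : ℝ} (hS : 0 ≤ S)
    (hδ : δ ∈ Set.Icc (0 : ℝ) 1)
    (htaylor : ∀ y₁ y₂, ‖H y₁ - H y₂ - fderiv ℝ H y₂ (y₁ - y₂)‖ ≤ S * ‖y₁ - y₂‖ ^ (1 + δ))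
    {a ξ : Ω → E} {Y g ψ : Ω → E'} (ha : StronglyMeasurable[m] a) (hY : StronglyMeasurable[m] Y)
    (hg : StronglyMeasurable[m] g) (ha2 : MemLp a 2 μ) (hg2 : MemLp g 2 μ)
    (hξ2 : MemLp ξ 2 μ) (hψ2 : MemLp ψ 2 μ)
    (hξ0 : μ[ξ | m] =ᵐ[μ] 0) (hψ0 : μ[ψ | m] =ᵐ[μ] 0) {C₁ C₂ : ℝ}
    (hC₁ : ∀ᵐ ω ∂μ, (μ[fun ω => ‖ξ ω‖ ^ 2 | m]) ω ≤ C₁)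
    (hC₂ : ∀ᵐ ω ∂μ, (μ[fun ω => ‖ψ ω‖ ^ 2 | m]) ω ≤ C₂) (α : ℝ) {β : ℝ} (hβ : 0 ≤ β) :
    ∀ᵐ ω ∂μ,
      (μ[fun ω => ‖a ω - α • ξ ω + (H (Y ω) - H (Y ω - β • (g ω + ψ ω)))‖ ^ 2 | m]) ω ≤
        (‖a ω‖ ^ 2 + 2 * l * β * (‖a ω‖ * ‖g ω‖) + 2 * l ^ 2 * β ^ 2 * ‖g ω‖ ^ 2) +
        2 * ‖a ω‖ * (S * β ^ (1 + δ) * C₂ ^ ((1 + δ) / 2)) +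
        2 * α ^ 2 * C₁ + 2 * l ^ 2 * β ^ 2 * C₂ := by
  have hlipW : LipschitzWith ⟨l, hl⟩ H :=
    LipschitzWith.of_dist_le_mul fun y₁ y₂ => by
      rw [dist_eq_norm, dist_eq_norm]
      exact hlip y₁ y₂
  have hHc : Continuous H := hlipW.continuous
  have hL : ∀ y, ‖fderiv ℝ H y‖ ≤ l := fun y => norm_fderiv_le_of_lipschitz ℝ hlipW
  set w : Ω → E' := fun ω => Y ω - β • g ω with hw
  have hwm : StronglyMeasurable[m] w := hY.sub (hg.const_smul β)
  have hLm : StronglyMeasurable[m] fun ω => fderiv ℝ H (w ω) :=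
    ((measurable_fderiv ℝ H).comp hwm.measurable).stronglyMeasurable
  set r : Ω → E := fun ω => H (w ω) - H (w ω - β • ψ ω) - β • fderiv ℝ H (w ω) (ψ ω) with hr
  have hwm' := (hwm.mono hm).aestronglyMeasurable (μ := μ)
  have hLm' := (hLm.mono hm).aestronglyMeasurable (μ := μ)
  have hrm : AEStronglyMeasurable r μ :=
    ((hHc.comp_aestronglyMeasurable hwm').sub (hHc.comp_aestronglyMeasurable
      (hwm'.sub (hψ2.aestronglyMeasurable.const_smul β)))).sub
      ((isBoundedBilinearMap_apply.continuous.comp_aestronglyMeasurable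
        (hLm'.prodMk hψ2.aestronglyMeasurable)).const_smul β)
  have hr2 : MemLp r 2 μ := by
    refine hψ2.of_le_mul (c := 2 * l * β) hrm (Eventually.of_forall fun ω => ?_)
    calc ‖r ω‖ ≤ ‖H (w ω) - H (w ω - β • ψ ω)‖ + ‖β • fderiv ℝ H (w ω) (ψ ω)‖ := norm_sub_le _ _
      _ ≤ l * (β * ‖ψ ω‖) + β * (l * ‖ψ ω‖) := by
          refine add_le_add ((hlip _ _).trans_eq ?_) ?_
          · rw [sub_sub_cancel, norm_smul, Real.norm_of_nonneg hβ]
          · rw [norm_smul, Real.norm_of_nonneg hβ]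
            gcongr
            exact (fderiv ℝ H (w ω)).le_of_opNorm_le (hL _) _
      _ = 2 * l * β * ‖ψ ω‖ := by ring
  have hrb : ∀ ω, ‖r ω‖ ≤ S * β ^ (1 + δ) * (‖ψ ω‖ ^ 2) ^ ((1 + δ) / 2) := by
    intro ω
    have h := htaylor (w ω - β • ψ ω) (w ω)
    rw [show w ω - β • ψ ω - w ω = -(β • ψ ω) by abel, norm_neg, norm_smul,
      Real.norm_of_nonneg hβ, Real.mul_rpow hβ (norm_nonneg _)] at h
    have h' : ‖r ω‖ = ‖H (w ω - β • ψ ω) - H (w ω) - fderiv ℝ H (w ω) (-(β • ψ ω))‖ := by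
      rw [← norm_neg, hr]
      congr 1
      simp only [map_neg, map_smul]
      abel
    rw [h', ← Real.rpow_natCast ‖ψ ω‖ 2, ← Real.rpow_mul (norm_nonneg _)]
    refine h.trans_eq ?_
    rw [show ((2 : ℕ) : ℝ) * ((1 + δ) / 2) = 1 + δ by push_cast; ring]
    ring
  have hψsq : Integrable (fun ω => ‖ψ ω‖ ^ 2) μ := hψ2.integrable_norm_pow two_ne_zero
  have hξsq : Integrable (fun ω => ‖ξ ω‖ ^ 2) μ := hξ2.integrable_norm_pow two_ne_zero
  obtain ⟨hpint, hpC⟩ := condExp_rpow_le_of_condExp_le hm (fun ω => sq_nonneg ‖ψ ω‖) hψsq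
    (p := (1 + δ) / 2) (by linarith [hδ.1]) (by linarith [hδ.2]) hC₂
  have hrC : ∀ᵐ ω ∂μ, (μ[fun ω => ‖r ω‖ | m]) ω ≤ S * β ^ (1 + δ) * C₂ ^ ((1 + δ) / 2) := by
    have h1 := condExp_mono (m := m) (hr2.integrable one_le_two).norm
      (hpint.const_mul (S * β ^ (1 + δ))) (Eventually.of_forall hrb)
    have h2 := condExp_smul (μ := μ) (S * β ^ (1 + δ)) (fun ω => (‖ψ ω‖ ^ 2) ^ ((1 + δ) / 2)) m
    filter_upwards [h1, h2, hpC] with ω h1 h2 h3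
    refine h1.trans (h2.trans_le ?_)
    exact mul_le_mul_of_nonneg_left h3 (by positivity)
  set Q : Ω → ℝ := fun ω =>
    ‖a ω‖ ^ 2 + 2 * l * β * (‖a ω‖ * ‖g ω‖) + 2 * l ^ 2 * β ^ 2 * ‖g ω‖ ^ 2
  have hQm : StronglyMeasurable[m] Q :=
    ((ha.norm.pow 2).add ((ha.norm.mul hg.norm).const_mul _)).add ((hg.norm.pow 2).const_mul _)
  have hQi : Integrable Q μ :=
    ((ha2.integrable_norm_pow two_ne_zero).add
      ((ha2.norm.integrable_mul hg2.norm).const_mul _)).add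
      ((hg2.integrable_norm_pow two_ne_zero).const_mul _)
  set u : Ω → E' := fun ω =>
    (2 * β) • (fderiv ℝ H (w ω)).adjoint (a ω) + (4 * l ^ 2 * β ^ 2) • g ω
  have hadj : StronglyMeasurable[m] fun ω => (fderiv ℝ H (w ω)).adjoint (a ω) :=
    isBoundedBilinearMap_apply.continuous.comp_stronglyMeasurable
      ((ContinuousLinearMap.adjoint.continuous.comp_stronglyMeasurable hLm).prodMk ha)
  have hadj2 : MemLp (fun ω => (fderiv ℝ H (w ω)).adjoint (a ω)) 2 μ := by
    refine ha2.of_le_mul (c := l) (hadj.mono hm).aestronglyMeasurable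
      (Eventually.of_forall fun ω => ?_)
    exact ContinuousLinearMap.le_of_opNorm_le _
      ((LinearIsometryEquiv.norm_map _ _).trans_le (hL _)) _
  have hum : StronglyMeasurable[m] u := (hadj.const_smul _).add (hg.const_smul _)
  have hu2 : MemLp u 2 μ := (hadj2.const_smul _).add (hg2.const_smul _)
  have hvm : StronglyMeasurable[m] fun ω => (-2 * α) • a ω := ha.const_smul _
  have hv2 : MemLp (fun ω => (-2 * α) • a ω) 2 μ := ha2.const_smul _
  have har : Integrable (fun ω => ‖a ω‖ * ‖r ω‖) μ := ha2.norm.integrable_mul hr2.norm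
  have hi3 := hu2.integrable_inner_of_two hψ2
  have hi4 := hv2.integrable_inner_of_two hξ2
  have hi2 : Integrable (fun ω => 2 * (‖a ω‖ * ‖r ω‖)) μ := har.const_mul 2
  have hi5 : Integrable (fun ω => (2 * α ^ 2) * ‖ξ ω‖ ^ 2) μ := hξsq.const_mul _
  have hi6 : Integrable (fun ω => (2 * l ^ 2 * β ^ 2) * ‖ψ ω‖ ^ 2) μ := hψsq.const_mul _
  have hpt : ∀ ω, ‖a ω - α • ξ ω + (H (Y ω) - H (Y ω - β • (g ω + ψ ω)))‖ ^ 2 ≤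
      Q ω + 2 * (‖a ω‖ * ‖r ω‖) + ⟪u ω, ψ ω⟫ + ⟪(-2 * α) • a ω, ξ ω⟫ +
      (2 * α ^ 2) * ‖ξ ω‖ ^ 2 + (2 * l ^ 2 * β ^ 2) * ‖ψ ω‖ ^ 2 := by
    intro ω
    have hdec : H (Y ω) - H (w ω) + (r ω + β • fderiv ℝ H (w ω) (ψ ω)) =
        H (Y ω) - H (Y ω - β • (g ω + ψ ω)) := by
      simp only [hr, hw, smul_add, sub_sub]
      abel
    have h := norm_sq_add_perturbation_le (fderiv ℝ H (w ω)) (a ω) (ξ ω) (H (Y ω) - H (w ω))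
      (r ω) (g ω) (ψ ω) (α := α) (β := β) (l := l)
      ((hlip _ _).trans_eq (by rw [hw, sub_sub_cancel, norm_smul, Real.norm_of_nonneg hβ]))
      (hdec ▸ (hlip _ _).trans_eq (by rw [sub_sub_cancel, norm_smul, Real.norm_of_nonneg hβ]))
    rwa [hdec] at h
  have hsum := ((((hQi.add hi2).add hi3).add hi4).add hi5).add hi6
  have hDm : AEStronglyMeasurable (fun ω => ‖a ω - α • ξ ω +
      (H (Y ω) - H (Y ω - β • (g ω + ψ ω)))‖ ^ 2) μ := by
    have hY' := (hY.mono hm).aestronglyMeasurable (μ := μ)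
    exact ((ha2.aestronglyMeasurable.sub (hξ2.aestronglyMeasurable.const_smul α)).add
      ((hHc.comp_aestronglyMeasurable hY').sub (hHc.comp_aestronglyMeasurable
        (hY'.sub ((hg2.aestronglyMeasurable.add
          hψ2.aestronglyMeasurable).const_smul β))))).norm.pow 2
  have hlhs : Integrable (fun ω => ‖a ω - α • ξ ω +
      (H (Y ω) - H (Y ω - β • (g ω + ψ ω)))‖ ^ 2) μ :=
    hsum.mono' hDm (Eventually.of_forall fun ω => by
      rw [Real.norm_of_nonneg (sq_nonneg _)]
      exact hpt ω)
  have hmono := condExp_mono (m := m) hlhs hsum (Eventually.of_forall hpt)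
  have e1 := condExp_add ((((hQi.add hi2).add hi3).add hi4).add hi5) hi6 m
  have e2 := condExp_add (((hQi.add hi2).add hi3).add hi4) hi5 m
  have e3 := condExp_add ((hQi.add hi2).add hi3) hi4 m
  have e4 := condExp_add (hQi.add hi2) hi3 m
  have e5 := condExp_add hQi hi2 m
  have c1 : μ[Q | m] = Q := condExp_of_stronglyMeasurable hm hQm hQi
  have c2 := condExp_smul (μ := μ) (2 : ℝ) (fun ω => ‖a ω‖ * ‖r ω‖) m
  have c2' := condExp_mul_of_stronglyMeasurable_left (μ := μ) ha.norm har
    (hr2.integrable one_le_two).norm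
  have c3 := condExp_inner_eq_zero hum hu2 hψ2 hψ0
  have c4 := condExp_inner_eq_zero hvm hv2 hξ2 hξ0
  have c5 := condExp_smul (μ := μ) (2 * α ^ 2) (fun ω => ‖ξ ω‖ ^ 2) m
  have c6 := condExp_smul (μ := μ) (2 * l ^ 2 * β ^ 2) (fun ω => ‖ψ ω‖ ^ 2) m
  filter_upwards [hmono, e1, e2, e3, e4, e5, c2, c2', c3, c4, c5, c6, hrC, hC₁, hC₂] with
    ω hmono e1 e2 e3 e4 e5 c2 c2' c3 c4 c5 c6 hrC hC₁ hC₂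
  refine hmono.trans (e1.trans_le ?_)
  simp only [Pi.add_apply, Pi.mul_apply, Pi.smul_apply, smul_eq_mul, Pi.zero_apply] at *
  rw [e2, e3, e4, e5, c1, c3, c4]
  have d2 : (μ[fun ω => 2 * (‖a ω‖ * ‖r ω‖) | m]) ω ≤
      2 * ‖a ω‖ * (S * β ^ (1 + δ) * C₂ ^ ((1 + δ) / 2)) := by
    have hle := mul_le_mul_of_nonneg_left hrC (norm_nonneg (a ω))
    have h : (μ[fun ω => 2 * (‖a ω‖ * ‖r ω‖) | m]) ω =
        2 * (‖a ω‖ * (μ[fun ω => ‖r ω‖ | m]) ω) := c2.trans (congrArg (2 * ·) c2')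
    linarith
  have d5 : (μ[fun ω => 2 * α ^ 2 * ‖ξ ω‖ ^ 2 | m]) ω ≤ 2 * α ^ 2 * C₁ :=
    c5.trans_le (mul_le_mul_of_nonneg_left hC₁ (by positivity))
  have d6 : (μ[fun ω => 2 * l ^ 2 * β ^ 2 * ‖ψ ω‖ ^ 2 | m]) ω ≤ 2 * l ^ 2 * β ^ 2 * C₂ :=
    c6.trans_le (mul_le_mul_of_nonneg_left hC₂ (by positivity))
  linarith

end InnerProduct

section Filtration

variable {Ω : Type} [mΩ : MeasurableSpace Ω] {dx dy : ℕ}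
  {x0 : Ω → EuclideanSpace ℝ (Fin dx)} {y0 : Ω → EuclideanSpace ℝ (Fin dy)}
  {ξ : ℕ → Ω → EuclideanSpace ℝ (Fin dx)} {ψ : ℕ → Ω → EuclideanSpace ℝ (Fin dy)}

lemma natFilt_le (hx0 : Measurable x0) (hy0 : Measurable y0) (hξ : ∀ t, Measurable (ξ t))
    (hψ : ∀ t, Measurable (ψ t)) (t : ℕ) : natFilt x0 y0 ξ ψ t ≤ mΩ :=
  sup_le (sup_le hx0.comap_le hy0.comap_le)
    (iSup₂_le fun s _ => sup_le (hξ s).comap_le (hψ s).comap_le)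

lemma natFilt_mono : Monotone (natFilt x0 y0 ξ ψ) := fun _ _ hst =>
  sup_le_sup_left (biSup_mono fun _ hi => Finset.range_mono hst hi) _

lemma measurable_natFilt_init_fast (t : ℕ) : Measurable[natFilt x0 y0 ξ ψ t] x0 :=
  measurable_iff_comap_le.2 (le_sup_left.trans le_sup_left)

lemma measurable_natFilt_init_slow (t : ℕ) : Measurable[natFilt x0 y0 ξ ψ t] y0 :=
  measurable_iff_comap_le.2 (le_sup_right.trans le_sup_left)

lemma comap_noise_le_natFilt_succ (t : ℕ) :
    MeasurableSpace.comap (ξ t) inferInstance ⊔ MeasurableSpace.comap (ψ t) inferInstance ≤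
      natFilt x0 y0 ξ ψ (t + 1) :=
  (le_iSup₂ (f := fun s (_ : s ∈ Finset.range (t + 1)) =>
    MeasurableSpace.comap (ξ s) inferInstance ⊔ MeasurableSpace.comap (ψ s) inferInstance) t
    (Finset.self_mem_range_succ t)).trans le_sup_right

lemma measurable_natFilt_succ_fast (t : ℕ) : Measurable[natFilt x0 y0 ξ ψ (t + 1)] (ξ t) :=
  measurable_iff_comap_le.2 (le_sup_left.trans (comap_noise_le_natFilt_succ t))

lemma measurable_natFilt_succ_slow (t : ℕ) : Measurable[natFilt x0 y0 ξ ψ (t + 1)] (ψ t) :=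
  measurable_iff_comap_le.2 (le_sup_right.trans (comap_noise_le_natFilt_succ t))

/-- The iterates of the two-time-scale recursion are adapted to the natural filtration. -/
lemma measurable_natFilt_iterates
    {F : EuclideanSpace ℝ (Fin dx) → EuclideanSpace ℝ (Fin dy) → EuclideanSpace ℝ (Fin dx)}
    {G : EuclideanSpace ℝ (Fin dx) → EuclideanSpace ℝ (Fin dy) → EuclideanSpace ℝ (Fin dy)}
    {alpha beta : ℕ → ℝ}
    {x : ℕ → Ω → EuclideanSpace ℝ (Fin dx)} {y : ℕ → Ω → EuclideanSpace ℝ (Fin dy)}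
    (hxupd : ∀ t ω, x (t + 1) ω = x t ω - alpha t • (F (x t ω) (y t ω) + ξ t ω))
    (hyupd : ∀ t ω, y (t + 1) ω = y t ω - beta t • (G (x t ω) (y t ω) + ψ t ω))
    (hF : Measurable fun p : EuclideanSpace ℝ (Fin dx) × EuclideanSpace ℝ (Fin dy) => F p.1 p.2)
    (hG : Measurable fun p : EuclideanSpace ℝ (Fin dx) × EuclideanSpace ℝ (Fin dy) => G p.1 p.2)
    (t : ℕ) :
    Measurable[natFilt (x 0) (y 0) ξ ψ t] (x t) ∧ Measurable[natFilt (x 0) (y 0) ξ ψ t] (y t) := by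
  induction t with
  | zero => exact ⟨measurable_natFilt_init_fast 0, measurable_natFilt_init_slow 0⟩
  | succ t ih =>
    have hle := natFilt_mono (x0 := x 0) (y0 := y 0) (ξ := ξ) (ψ := ψ) t.le_succ
    have hx := ih.1.mono hle le_rfl
    have hy := ih.2.mono hle le_rfl
    rw [show x (t + 1) = _ from funext (hxupd t), show y (t + 1) = _ from funext (hyupd t)]
    exact ⟨hx.sub
        (((hF.comp (hx.prodMk hy)).add (measurable_natFilt_succ_fast t)).const_smul (alpha t)),
      hy.sub (((hG.comp (hx.prodMk hy)).add (measurable_natFilt_succ_slow t)).const_smul (beta t))⟩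

end Filtration

section Residuals

variable {E : Type*} [NormedAddCommGroup E] {E' : Type*} [NormedAddCommGroup E']

lemma memLp_residual_of_lipschitz {Ω : Type*} {mΩ : MeasurableSpace Ω} {μ : Measure Ω}
    [IsFiniteMeasure μ] {H : E' → E} (hHc : Continuous H) {l : ℝ}
    (hlip : ∀ y₁ y₂, ‖H y₁ - H y₂‖ ≤ l * ‖y₁ - y₂‖) {X : Ω → E} {Y : Ω → E'}
    (hX : MemLp X 2 μ) (hY : MemLp Y 2 μ) : MemLp (fun ω => X ω - H (Y ω)) 2 μ := by
  have h : MemLp (fun ω => H (Y ω) - H 0) 2 μ :=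
    hY.of_le_mul (c := l)
      ((hHc.comp_aestronglyMeasurable hY.aestronglyMeasurable).sub aestronglyMeasurable_const)
      (Eventually.of_forall fun ω => by simpa using hlip (Y ω) 0)
  have h' := (hX.sub h).sub (memLp_const (H 0))
  refine h'.ae_eq (Eventually.of_forall fun ω => ?_)
  simp only [Pi.sub_apply]
  abel

end Residuals

/-- A gradient-like step with a strongly monotone Lipschitz direction contracts. -/
lemma norm_sub_smul_sq_le {E : Type*} [NormedAddCommGroup E] [InnerProductSpace ℝ E] {u f : E}
    {m l α : ℝ} (hα : 0 < α) (hmono : m * ‖u‖ ^ 2 ≤ ⟪u, f⟫) (hlip : ‖f‖ ≤ l * ‖u‖)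
    (hstep : 4 * (α * l ^ 2) ≤ m) : ‖u - α • f‖ ^ 2 ≤ (1 - 7 / 4 * (m * α)) * ‖u‖ ^ 2 := by
  have h1 : ‖f‖ ^ 2 ≤ l ^ 2 * ‖u‖ ^ 2 := by
    rw [← mul_pow]
    gcongr
  have h2 : 4 * (α * l ^ 2) * (α * ‖u‖ ^ 2) ≤ m * (α * ‖u‖ ^ 2) := by gcongr
  rw [norm_sub_sq_real, inner_smul_right, norm_smul, mul_pow, Real.norm_eq_abs, sq_abs]
  have h3 := mul_le_mul_of_nonneg_left hmono hα.le
  have h4 := mul_le_mul_of_nonneg_left h1 (sq_nonneg α)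
  nlinarith

/-- Absorption of the cross terms of the one-step expansion into the contraction, where `A` is the
size of the contracted residual, `X` and `Y` those of the residuals, `g` that of the slow
direction and `T` that of the Taylor remainder. -/
lemma fast_cross_terms_le {A X Y g T W l β k q : ℝ} (hA0 : 0 ≤ A) (hX : 0 ≤ X) (hY : 0 ≤ Y)
    (hg0 : 0 ≤ g) (hW : 0 < W) (hl : 0 ≤ l) (hβ : 0 ≤ β) (hk : 0 ≤ k) (hq : 0 ≤ q)
    (hA : A ^ 2 ≤ (1 - 7 / 4 * W) * X ^ 2) (hg : g ≤ k * X + q * Y)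
    (hcross : 28 * (l * β * k) ≤ W) (hquad : 16 * (l ^ 2 * k ^ 2 * β ^ 2) ≤ W) :
    A ^ 2 + 2 * l * β * (A * g) + 2 * l ^ 2 * β ^ 2 * g ^ 2 + 2 * A * T ≤
      (1 - W) * X ^ 2 + 4 * l ^ 2 * q ^ 2 * β ^ 2 * Y ^ 2 +
        7 * l * q * β * √(1 - W) * (X * Y) + 16 * T ^ 2 / W := by
  have hAX : A ≤ X := by
    refine le_of_sq_le_sq ?_ hX
    nlinarith [mul_nonneg hW.le (sq_nonneg X)]
  have hAs : A ≤ √(1 - W) * X := by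
    have h : A ^ 2 ≤ (1 - W) * X ^ 2 := by nlinarith [mul_nonneg hW.le (sq_nonneg X)]
    calc A = √(A ^ 2) := (Real.sqrt_sq hA0).symm
      _ ≤ √((1 - W) * X ^ 2) := Real.sqrt_le_sqrt h
      _ = √(1 - W) * X := by rw [Real.sqrt_mul' _ (sq_nonneg X), Real.sqrt_sq hX]
  have h1 : 2 * l * β * (A * g) ≤
      2 * (l * β * k) * X ^ 2 + 2 * l * q * β * √(1 - W) * (X * Y) := by
    calc 2 * l * β * (A * g) ≤ 2 * l * β * (A * (k * X + q * Y)) := by gcongr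
      _ = 2 * l * β * k * X * A + 2 * l * q * β * Y * A := by ring
      _ ≤ 2 * l * β * k * X * X + 2 * l * q * β * Y * (√(1 - W) * X) := by gcongr
      _ = _ := by ring
  have h2 : 2 * l ^ 2 * β ^ 2 * g ^ 2 ≤
      4 * (l ^ 2 * k ^ 2 * β ^ 2) * X ^ 2 + 4 * l ^ 2 * q ^ 2 * β ^ 2 * Y ^ 2 := by
    calc 2 * l ^ 2 * β ^ 2 * g ^ 2 ≤ 2 * l ^ 2 * β ^ 2 * (k * X + q * Y) ^ 2 := by gcongr
      _ ≤ 2 * l ^ 2 * β ^ 2 * (2 * ((k * X) ^ 2 + (q * Y) ^ 2)) := by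
          gcongr
          exact add_sq_le
      _ = _ := by ring
  have h3 : 2 * A * T ≤ W / 16 * X ^ 2 + 16 * T ^ 2 / W := by
    have h : 0 ≤ (W * A - 16 * T) ^ 2 / (16 * W) := by positivity
    have h' : (W * A - 16 * T) ^ 2 / (16 * W) = W / 16 * A ^ 2 - 2 * A * T + 16 * T ^ 2 / W := by
      field_simp
      ring
    have h'' : W / 16 * A ^ 2 ≤ W / 16 * X ^ 2 := by gcongr
    linarith
  have h4 : 28 * (l * β * k) * X ^ 2 ≤ W * X ^ 2 := by gcongr
  have h5 : 16 * (l ^ 2 * k ^ 2 * β ^ 2) * X ^ 2 ≤ W * X ^ 2 := by gcongr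
  have h6 : 0 ≤ l * q * β * √(1 - W) * (X * Y) := by positivity
  have h7 : 0 ≤ W * X ^ 2 := by positivity
  linarith

/-- Lemma E.1 (one-step descent lemma of the fast iterate). -/
theorem one_step_descent_fast
    {Ω : Type} [MeasurableSpace Ω] (μ : Measure Ω) [IsProbabilityMeasure μ]
    {dx dy : ℕ}
    (F : EuclideanSpace ℝ (Fin dx) → EuclideanSpace ℝ (Fin dy) → EuclideanSpace ℝ (Fin dx))
    (G : EuclideanSpace ℝ (Fin dx) → EuclideanSpace ℝ (Fin dy) → EuclideanSpace ℝ (Fin dy))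
    (H : EuclideanSpace ℝ (Fin dy) → EuclideanSpace ℝ (Fin dx))
    (xstar : EuclideanSpace ℝ (Fin dx)) (ystar : EuclideanSpace ℝ (Fin dy))
    (hFroot : F xstar ystar = 0) (hGroot : G xstar ystar = 0)
    -- Assumption 1
    (LH LF : ℝ) (hLH : 0 ≤ LH) (hLF : 0 ≤ LF)
    (hFH : ∀ y, F (H y) y = 0)
    (hFHuniq : ∀ y x', F x' y = 0 → x' = H y)
    (hHlip : ∀ y₁ y₂, ‖H y₁ - H y₂‖ ≤ LH * ‖y₁ - y₂‖)
    (hFlip : ∀ x' y, ‖F x' y - F (H y) y‖ ≤ LF * ‖x' - H y‖)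
    -- Assumption 2
    (LGx LGy : ℝ) (hLGx : 0 ≤ LGx) (hLGy : 0 ≤ LGy)
    (hGlipx : ∀ x' y, ‖G x' y - G (H y) y‖ ≤ LGx * ‖x' - H y‖)
    (hGlipy : ∀ y, ‖G (H y) y - G (H ystar) ystar‖ ≤ LGy * ‖y - ystar‖)
    -- Assumption 3
    (muF muG : ℝ) (hmuF : 0 < muF) (hmuG : 0 < muG)
    (hFmono : ∀ x' y, muF * ‖x' - H y‖ ^ 2 ≤ ⟪x' - H y, F x' y - F (H y) y⟫)
    (hGmono : ∀ y, muG * ‖y - ystar‖ ^ 2 ≤ ⟪y - ystar, G (H y) y - G (H ystar) ystar⟫)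
    -- Assumption 4
    (H' : EuclideanSpace ℝ (Fin dy) → (EuclideanSpace ℝ (Fin dy) →L[ℝ] EuclideanSpace ℝ (Fin dx)))
    (hH' : ∀ y, HasFDerivAt H (H' y) y)
    (SH dH : ℝ) (hSH : 0 ≤ SH) (hdH : dH ∈ Set.Icc (0 : ℝ) 1)
    (hHtaylor : ∀ y₁ y₂, ‖H y₁ - H y₂ - H' y₂ (y₁ - y₂)‖ ≤ SH * ‖y₁ - y₂‖ ^ (1 + dH))
    -- the two-time-scale stochastic approximation process
    (alpha beta : ℕ → ℝ) (halpha : ∀ t, 0 < alpha t) (hbeta : ∀ t, 0 < beta t)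
    (ξ : ℕ → Ω → EuclideanSpace ℝ (Fin dx)) (ψ : ℕ → Ω → EuclideanSpace ℝ (Fin dy))
    (x : ℕ → Ω → EuclideanSpace ℝ (Fin dx)) (y : ℕ → Ω → EuclideanSpace ℝ (Fin dy))
    (hxupd : ∀ t ω, x (t + 1) ω = x t ω - alpha t • (F (x t ω) (y t ω) + ξ t ω))
    (hyupd : ∀ t ω, y (t + 1) ω = y t ω - beta t • (G (x t ω) (y t ω) + ψ t ω))
    -- measurability
    (hFmeas : Measurable fun p : EuclideanSpace ℝ (Fin dx) × EuclideanSpace ℝ (Fin dy) => F p.1 p.2)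
    (hGmeas : Measurable fun p : EuclideanSpace ℝ (Fin dx) × EuclideanSpace ℝ (Fin dy) => G p.1 p.2)
    (hx0meas : Measurable (x 0)) (hy0meas : Measurable (y 0))
    (hξmeas : ∀ t, Measurable (ξ t)) (hψmeas : ∀ t, Measurable (ψ t))
    -- finite initial second moments
    (hx0L2 : Integrable (fun ω => ‖x 0 ω‖ ^ 2) μ) (hy0L2 : Integrable (fun ω => ‖y 0 ω‖ ^ 2) μ)
    -- noise assumption (martingale differences with bounded second conditional moments)
    (Γ11 Γ22 : ℝ) (hΓ11 : 0 ≤ Γ11) (hΓ22 : 0 ≤ Γ22)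
    (hξmean : ∀ t, μ[ξ t | natFilt (x 0) (y 0) ξ ψ t] =ᵐ[μ] 0)
    (hψmean : ∀ t, μ[ψ t | natFilt (x 0) (y 0) ξ ψ t] =ᵐ[μ] 0)
    (hξ2int : ∀ t, Integrable (fun ω => ‖ξ t ω‖ ^ 2) μ)
    (hψ2int : ∀ t, Integrable (fun ω => ‖ψ t ω‖ ^ 2) μ)
    (hξ2 : ∀ t, ∀ᵐ ω ∂μ, (μ[fun ω' => ‖ξ t ω'‖ ^ 2 | natFilt (x 0) (y 0) ξ ψ t]) ω ≤ Γ11)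
    (hψ2 : ∀ t, ∀ᵐ ω ∂μ, (μ[fun ω' => ‖ψ t ω'‖ ^ 2 | natFilt (x 0) (y 0) ξ ψ t]) ω ≤ Γ22)
    -- appendix step-size assumption
    (hαub : ∀ t, alpha t ≤ muF / (4 * LF ^ 2))
    (hβub : ∀ t, beta t ≤ muG / LGy ^ 2)
    (hκub : ∀ t, beta t / alpha t ≤ min (muF * muG / (28 * LH * LGx * max 1 LGy)) (muF / muG))
    (hρub : ∀ t, beta t ^ 2 / alpha t ≤ muF / (16 * LH ^ 2 * LGx ^ 2))
    (hαgrow : ∀ t, alpha (t + 1) ≤ alpha t ∧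
      alpha t / alpha (t + 1) ≤ 1 + min (muF * alpha (t + 1) / 4) (muG * beta (t + 1) / 8))
    (hβgrow : ∀ t, beta (t + 1) ≤ beta t ∧ beta t / beta (t + 1) ≤ 1 + muG * beta (t + 1) / 32)
 :
    ∀ t : ℕ, ∀ᵐ ω ∂μ,
      (μ[fun ω' => ‖x (t + 1) ω' - H (y (t + 1) ω')‖ ^ 2 | natFilt (x 0) (y 0) ξ ψ t]) ω ≤
        (1 - muF * alpha t) * ‖x t ω - H (y t ω)‖ ^ 2 +
        4 * LH ^ 2 * LGy ^ 2 * beta t ^ 2 * ‖y t ω - ystar‖ ^ 2 +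
        2 * Γ11 * alpha t ^ 2 +
        7 * LH * LGy * beta t * Real.sqrt (1 - muF * alpha t) *
          (‖x t ω - H (y t ω)‖ * ‖y t ω - ystar‖) +
        2 * LH ^ 2 * Γ22 * beta t ^ 2 +
        16 * SH ^ 2 * Γ22 ^ (1 + dH) / muF * (beta t ^ (2 + 2 * dH) / alpha t) := by
  have hLF0 : LF ≠ 0 := by
    rintro rfl
    have h := hαub 0
    simp at h
    exact absurd (halpha 0) (not_lt.2 h)
  have hκ : ∀ t, 28 * LH * LGx * max 1 LGy * beta t ≤ muF * muG * alpha t ∧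
      0 < 28 * LH * LGx * max 1 LGy := by
    intro t
    have h := (hκub t).trans (min_le_left _ _)
    have hpos : 0 < 28 * LH * LGx * max 1 LGy := by
      refine lt_of_le_of_ne (by positivity) fun h0 => ?_
      rw [← h0, div_zero] at h
      exact absurd (div_pos (hbeta t) (halpha t)) (not_lt.2 h)
    rw [div_le_div_iff₀ (halpha t) hpos] at h
    exact ⟨by linarith, hpos⟩
  have hLHGx : 0 < LH * LGx := by
    have h := (hκ 0).2
    have hmax : (0 : ℝ) < max 1 LGy := lt_max_of_lt_left one_pos
    have h' := pos_of_mul_pos_left h hmax.le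
    linarith
  have hHc : Continuous H := continuous_iff_continuousAt.2 fun y => (hH' y).continuousAt
  have hHstar : H ystar = xstar := (hFHuniq ystar xstar hFroot).symm
  have hGH : G (H ystar) ystar = 0 := by rw [hHstar, hGroot]
  have hFb : ∀ x' y, ‖F x' y‖ ≤ LF * ‖x' - H y‖ := fun x' y => by
    simpa [hFH] using hFlip x' y
  have hGb : ∀ x' y, ‖G x' y‖ ≤ LGx * ‖x' - H y‖ + LGy * ‖y - ystar‖ := fun x' y => by
    have h := hGlipy y
    rw [hGH, sub_zero] at h
    linarith [norm_le_norm_sub_add (G x' y) (G (H y) y), hGlipx x' y]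
  have hm : ∀ t, natFilt (x 0) (y 0) ξ ψ t ≤ _ := natFilt_le hx0meas hy0meas hξmeas hψmeas
  have hadapt := measurable_natFilt_iterates hxupd hyupd hFmeas hGmeas
  have hξL : ∀ t, MemLp (ξ t) 2 μ := fun t =>
    (memLp_two_iff_integrable_sq_norm (hξmeas t).aestronglyMeasurable).2 (hξ2int t)
  have hψL : ∀ t, MemLp (ψ t) 2 μ := fun t =>
    (memLp_two_iff_integrable_sq_norm (hψmeas t).aestronglyMeasurable).2 (hψ2int t)
  have hFGL : ∀ t, MemLp (x t) 2 μ → MemLp (y t) 2 μ →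
      MemLp (fun ω => F (x t ω) (y t ω)) 2 μ ∧ MemLp (fun ω => G (x t ω) (y t ω)) 2 μ := by
    intro t hx hy
    have hxm := (hadapt t).1.mono (hm t) le_rfl
    have hym := (hadapt t).2.mono (hm t) le_rfl
    have hres := memLp_residual_of_lipschitz hHc hHlip hx hy
    refine ⟨hres.of_le_mul (hFmeas.comp (hxm.prodMk hym)).aestronglyMeasurable
      (Eventually.of_forall fun ω => hFb _ _), ?_⟩
    refine ((hres.norm.const_mul LGx).add ((hy.sub (memLp_const ystar)).norm.const_mul LGy)).mono
      (hGmeas.comp (hxm.prodMk hym)).aestronglyMeasurable (Eventually.of_forall fun ω => ?_)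
    exact (hGb _ _).trans (Real.le_norm_self _)
  have hL2 : ∀ t, MemLp (x t) 2 μ ∧ MemLp (y t) 2 μ := by
    intro t
    induction t with
    | zero =>
      exact ⟨(memLp_two_iff_integrable_sq_norm hx0meas.aestronglyMeasurable).2 hx0L2,
        (memLp_two_iff_integrable_sq_norm hy0meas.aestronglyMeasurable).2 hy0L2⟩
    | succ t ih =>
      obtain ⟨hF2, hG2⟩ := hFGL t ih.1 ih.2
      rw [show x (t + 1) = _ from funext (hxupd t), show y (t + 1) = _ from funext (hyupd t)]
      exact ⟨ih.1.sub ((hF2.add (hξL t)).const_smul (alpha t)),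
        ih.2.sub ((hG2.add (hψL t)).const_smul (beta t))⟩
  intro t
  have hα := halpha t
  have hβ := hbeta t
  obtain ⟨hx2, hy2⟩ := hL2 t
  obtain ⟨hF2, hG2⟩ := hFGL t hx2 hy2
  obtain ⟨hxm, hym⟩ := hadapt t
  have hstep := condExp_norm_sq_step_le (μ := μ) (hm t) hLH hHlip hSH hdH
    (fun y₁ y₂ => by simpa only [(hH' y₂).fderiv] using hHtaylor y₁ y₂)
    (a := fun ω => x t ω - H (y t ω) - alpha t • F (x t ω) (y t ω)) (ξ := ξ t) (Y := y t)
    (g := fun ω => G (x t ω) (y t ω)) (ψ := ψ t)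
    ((hxm.sub (hHc.measurable.comp hym)).sub
      ((hFmeas.comp (hxm.prodMk hym)).const_smul (alpha t))).stronglyMeasurable
    hym.stronglyMeasurable (hGmeas.comp (hxm.prodMk hym)).stronglyMeasurable
    ((memLp_residual_of_lipschitz hHc hHlip hx2 hy2).sub (hF2.const_smul (alpha t)))
    hG2 (hξL t) (hψL t) (hξmean t) (hψmean t) (hξ2 t) (hψ2 t) (alpha t) hβ.le
  have hupd : (fun ω => ‖x (t + 1) ω - H (y (t + 1) ω)‖ ^ 2) = fun ω =>
      ‖x t ω - H (y t ω) - alpha t • F (x t ω) (y t ω) - alpha t • ξ t ω +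
        (H (y t ω) - H (y t ω - beta t • (G (x t ω) (y t ω) + ψ t ω)))‖ ^ 2 := by
    funext ω
    rw [hxupd, hyupd, smul_add]
    congr 2
    abel
  rw [hupd]
  have hαstep : 4 * (alpha t * LF ^ 2) ≤ muF := by
    have h := hαub t
    rw [le_div_iff₀ (by positivity)] at h
    linarith
  have hquad : 16 * (LH ^ 2 * LGx ^ 2 * beta t ^ 2) ≤ muF * alpha t := by
    have h := hρub t
    have h0 : 0 < 16 * LH ^ 2 * LGx ^ 2 := by
      rw [mul_assoc, ← mul_pow]
      positivity
    rw [div_le_div_iff₀ hα h0] at h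
    linarith
  have hslow : ∃ k : ℝ, 0 ≤ k ∧ (∀ x' y, ‖G x' y‖ ≤ k * ‖x' - H y‖ + LGy * ‖y - ystar‖) ∧
      28 * (LH * beta t * k) ≤ muF * alpha t ∧
      16 * (LH ^ 2 * k ^ 2 * beta t ^ 2) ≤ muF * alpha t := by
    rcases subsingleton_or_nontrivial (EuclideanSpace ℝ (Fin dy)) with hsub | hnon
    · refine ⟨0, le_rfl, fun x' y => ?_, ?_, ?_⟩
      · rw [Subsingleton.elim (G x' y) 0, norm_zero]
        positivity
      · rw [mul_zero, mul_zero]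
        positivity
      · rw [zero_pow two_ne_zero, mul_zero, zero_mul, mul_zero]
        positivity
    · refine ⟨LGx, hLGx, hGb, ?_, hquad⟩
      obtain ⟨y', hy'⟩ := exists_ne ystar
      have hpos : 0 < ‖y' - ystar‖ := norm_pos_iff.2 (sub_ne_zero.2 hy')
      have hmuGLGy : muG ≤ LGy := by
        have h : muG * ‖y' - ystar‖ ^ 2 ≤ LGy * ‖y' - ystar‖ ^ 2 :=
          (hGmono y').trans <| (real_inner_le_norm _ _).trans <|
            (mul_le_mul_of_nonneg_left (hGlipy y') hpos.le).trans_eq (by ring)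
        exact le_of_mul_le_mul_right h (by positivity)
      have hmax : muG ≤ max 1 LGy := hmuGLGy.trans (le_max_right _ _)
      have hmax0 : (0 : ℝ) < max 1 LGy := lt_max_of_lt_left one_pos
      have h1 := (hκ t).1
      have h2 : muF * alpha t * muG ≤ muF * alpha t * max 1 LGy := by gcongr
      refine le_of_mul_le_mul_right ?_ hmax0
      linarith
  obtain ⟨k, hk, hGk, hcross, hquadk⟩ := hslow
  filter_upwards [hstep] with ω hω
  refine hω.trans ?_
  have hcontr := norm_sub_smul_sq_le (u := x t ω - H (y t ω)) (f := F (x t ω) (y t ω)) hα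
    (by simpa [hFH] using hFmono (x t ω) (y t ω)) (hFb _ _) hαstep
  have habs := fast_cross_terms_le (T := SH * beta t ^ (1 + dH) * Γ22 ^ ((1 + dH) / 2))
    (norm_nonneg _) (norm_nonneg _) (norm_nonneg (y t ω - ystar)) (norm_nonneg _)
    (mul_pos hmuF hα) hLH hβ.le hk hLGy hcontr (hGk (x t ω) (y t ω)) hcross hquadk
  have hT : 16 * (SH * beta t ^ (1 + dH) * Γ22 ^ ((1 + dH) / 2)) ^ 2 / (muF * alpha t) =
      16 * SH ^ 2 * Γ22 ^ (1 + dH) / muF * (beta t ^ (2 + 2 * dH) / alpha t) := by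
    have h1 : (beta t ^ (1 + dH)) ^ 2 = beta t ^ (2 + 2 * dH) := by
      rw [← Real.rpow_mul_natCast hβ.le]
      congr 1
      push_cast
      ring
    have h2 : (Γ22 ^ ((1 + dH) / 2)) ^ 2 = Γ22 ^ (1 + dH) := by
      rw [← Real.rpow_mul_natCast hΓ22]
      congr 1
      push_cast
      ring
    rw [mul_pow, mul_pow, h1, h2, div_mul_div_comm]
    ring
  rw [hT] at habs
  linarith
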